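/- Let G = K_c ⊕ H be a connected quasi-threshold graph, where c ≥ 1 is an integer and H is a disconnected quasi-threshold graph, and suppose G has exactly k main Q-eigenvalues with k ≥ 2. Then exactly one of the following holds: (a) the complement of H is not bipartite, and the complement of H has exactly k−1 main Q-eigenvalues, all of which are nonzero; or (b) the complement of H is bipartite, and k = 2. -/

import Mathlib

open SimpleGraph

/-- The signless Laplacian matrix `Q(G) = D(G) + A(G)` of a finite simple graph. -/
noncomputable def signlessLaplacian {V : Type*} [Fintype V] (G : SimpleGraph V) :
    Matrix V V ℝ :=
  letI := Classical.decEq V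
  letI := Classical.decRel G.Adj
  Matrix.diagonal (fun v => (G.degree v : ℝ)) + G.adjMatrix ℝ

/-- `q` is a main Q-eigenvalue of `G`: some eigenvector of `Q(G)` for `q`
has nonzero entry sum. -/
def IsMainQEigenvalue {V : Type*} [Fintype V] (G : SimpleGraph V) (q : ℝ) : Prop :=
  ∃ x : V → ℝ, (signlessLaplacian G).mulVec x = q • x ∧ (∑ v, x v) ≠ 0

/-- The number of (distinct) main Q-eigenvalues of `G`. -/
noncomputable def mainQCount {V : Type*} [Fintype V] (G : SimpleGraph V) : ℕ :=
  {q : ℝ | IsMainQEigenvalue G q}.ncard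

/-- `G` contains an induced copy of `H`. -/
def HasInducedCopy {α β : Type*} (H : SimpleGraph α) (G : SimpleGraph β) : Prop :=
  ∃ f : α ↪ β, ∀ a b : α, H.Adj a b ↔ G.Adj (f a) (f b)

/-- A cograph is a `P₄`-free graph. -/
def IsCograph {V : Type*} (G : SimpleGraph V) : Prop :=
  ¬ HasInducedCopy (SimpleGraph.pathGraph 4) G

/-- A quasi-threshold graph is a `{P₄, C₄}`-free graph. -/
def IsQuasiThreshold {V : Type*} (G : SimpleGraph V) : Prop :=
  ¬ HasInducedCopy (SimpleGraph.pathGraph 4) G ∧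
  ¬ HasInducedCopy (SimpleGraph.cycleGraph 4) G

/-- A chordal graph: no induced cycle of length at least 4. -/
def IsChordal {V : Type*} (G : SimpleGraph V) : Prop :=
  ∀ n : ℕ, 4 ≤ n → ¬ HasInducedCopy (SimpleGraph.cycleGraph n) G

/-- The join `G ⊕ H` of two vertex-disjoint graphs. -/
def graphJoin {V W : Type*} (G : SimpleGraph V) (H : SimpleGraph W) :
    SimpleGraph (V ⊕ W) where
  Adj x y :=
    match x, y with
    | Sum.inl a, Sum.inl b => G.Adj a b
    | Sum.inr a, Sum.inr b => H.Adj a b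
    | Sum.inl _, Sum.inr _ => True
    | Sum.inr _, Sum.inl _ => True
  symm := by
    refine ⟨?_⟩
    rintro (a | a) (b | b) h
    · exact G.symm.symm _ _ h
    · trivial
    · trivial
    · exact H.symm.symm _ _ h
  loopless := by
    refine ⟨?_⟩
    rintro (a | a) h
    · exact G.loopless.irrefl a h
    · exact H.loopless.irrefl a h

/-- The disjoint union `G ∪ H` of two vertex-disjoint graphs. -/
def disjUnionGraph {V W : Type*} (G : SimpleGraph V) (H : SimpleGraph W) :
    SimpleGraph (V ⊕ W) where
  Adj x y :=
    match x, y with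
    | Sum.inl a, Sum.inl b => G.Adj a b
    | Sum.inr a, Sum.inr b => H.Adj a b
    | _, _ => False
  symm := by
    refine ⟨?_⟩
    rintro (a | a) (b | b) h
    · exact G.symm.symm _ _ h
    · exact h.elim
    · exact h.elim
    · exact H.symm.symm _ _ h
  loopless := by
    refine ⟨?_⟩
    rintro (a | a) h
    · exact G.loopless.irrefl a h
    · exact H.loopless.irrefl a h

/-- `tK_a`: the disjoint union of `t` copies of the complete graph `K_a`. -/
def copiesComplete (t a : ℕ) : SimpleGraph (Fin t × Fin a) where
  Adj x y := x.1 = y.1 ∧ x.2 ≠ y.2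
  symm := ⟨fun _ _ ⟨h1, h2⟩ => ⟨h1.symm, h2.symm⟩⟩
  loopless := ⟨fun _ ⟨_, h⟩ => h rfl⟩

/-- The disjoint union `a₁ K_{n₁} ∪ ⋯ ∪ a_p K_{n_p}`: for each `i : Fin p`,
`a i` copies of the complete graph on `n i` vertices. Two vertices are adjacent
iff they lie in the same copy of the same complete graph and are distinct. -/
def satellites (p : ℕ) (a n : Fin p → ℕ) :
    SimpleGraph ((i : Fin p) × (Fin (a i) × Fin (n i))) where
  Adj x y := x.1 = y.1 ∧ HEq x.2.1 y.2.1 ∧ ¬ HEq x.2.2 y.2.2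
  symm := ⟨fun _ _ ⟨h1, h2, h3⟩ => ⟨h1.symm, h2.symm, fun h => h3 h.symm⟩⟩
  loopless := ⟨fun _ ⟨_, _, h3⟩ => h3 HEq.rfl⟩

theorem invt_aeval {E : Type*} [AddCommGroup E] [Module ℝ E] (f : Module.End ℝ E)
    (p : Submodule ℝ E) (hp : ∀ x ∈ p, f x ∈ p) (P : Polynomial ℝ) (j : E) (hj : j ∈ p) :
    Polynomial.aeval f P j ∈ p := by
  induction P using Polynomial.induction_on' with
  | add a b ha hb => simpa using p.add_mem ha hb
  | monomial n a =>
    have h : ∀ n : ℕ, (f ^ n) j ∈ p := by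
      intro n
      induction n with
      | zero => simpa using hj
      | succ n ih => rw [pow_succ']; exact hp _ ih
    simpa [Polynomial.aeval_monomial, Algebra.algebraMap_eq_smul_one] using p.smul_mem a (h n)

/-- smallest invariant subspace containing `j` -/
def kry {E : Type*} [AddCommGroup E] [Module ℝ E] (f : Module.End ℝ E) (j : E) :
    Submodule ℝ E := sInf {p | j ∈ p ∧ ∀ x ∈ p, f x ∈ p}

theorem main_ncard_eq_finrank {E : Type*} [NormedAddCommGroup E] [InnerProductSpace ℝ E]
    [FiniteDimensional ℝ E] (f : Module.End ℝ E) (hf : LinearMap.IsSymmetric f) (j : E) :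
    {q : ℝ | ∃ x, f x = q • x ∧ inner ℝ j x ≠ 0}.ncard = Module.finrank ℝ (kry f j) ∧
    {q : ℝ | ∃ x, f x = q • x ∧ inner ℝ j x ≠ 0}.Finite := by
  classical
  set S := {q : ℝ | ∃ x, f x = q • x ∧ inner ℝ j x ≠ 0} with hS
  have hfin : S.Finite := by
    refine (Module.End.finite_hasEigenvalue f).subset ?_
    rintro q ⟨x, hx, hne⟩
    have hx0 : x ≠ 0 := by rintro rfl; simp at hne
    exact Module.End.hasEigenvalue_of_hasEigenvector
      ⟨Module.End.mem_eigenspace_iff.2 hx, hx0⟩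
  refine ⟨?_, hfin⟩
  let u : ℝ → E := fun q => (Module.End.eigenspace f q).starProjection j
  have hu : ∀ q, f (u q) = q • u q := fun q =>
    Module.End.mem_eigenspace_iff.1 (Submodule.starProjection_apply_mem _ _)
  have hin : ∀ q x, f x = q • x → inner ℝ (u q) x = inner ℝ j x := by
    intro q x hx
    have := Submodule.starProjection_inner_eq_zero (K := Module.End.eigenspace f q) j x
      (Module.End.mem_eigenspace_iff.2 hx)
    rw [inner_sub_left] at this
    linarith
  have hu0 : ∀ q ∈ S, u q ≠ 0 := by
    rintro q ⟨x, hx, hne⟩ h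
    apply hne
    rw [← hin q x hx, h, inner_zero_left]
  have horth : ∀ q r x, q ≠ r → f x = q • x → inner ℝ (u r) x = 0 := by
    intro q r x hqr hx
    have h := hf (u r) x
    rw [hu, hx, inner_smul_left, inner_smul_right] at h
    simp only [conj_trivial] at h
    have : (r - q) * inner ℝ (u r) x = 0 := by linarith
    rcases mul_eq_zero.1 this with h | h
    · exact absurd (by linarith) hqr
    · exact h
  have hsum : j = ∑ q ∈ hfin.toFinset, u q := by
    rw [← sub_eq_zero]
    have : j - ∑ q ∈ hfin.toFinset, u q ∈ (⨆ μ, Module.End.eigenspace f μ)ᗮ := by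
      rw [← Submodule.iInf_orthogonal, Submodule.mem_iInf]
      intro q
      rw [Submodule.mem_orthogonal']
      intro x hx
      rw [Module.End.mem_eigenspace_iff] at hx
      rw [inner_sub_left, sum_inner]
      by_cases hq : q ∈ S
      · rw [Finset.sum_eq_single q, hin q x hx, sub_self]
        · intro r _ hr
          exact horth q r x hr.symm hx
        · intro h; exact absurd (hfin.mem_toFinset.2 hq) h
      · rw [Finset.sum_eq_zero]
        · by_contra h
          exact hq ⟨x, hx, by simpa using h⟩
        · intro r hr
          exact horth q r x (by rintro rfl; exact hq (hfin.mem_toFinset.1 hr)) hx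
    rw [hf.orthogonalComplement_iSup_eigenspaces_eq_bot] at this
    simpa using this
  have haev : ∀ (P : Polynomial ℝ) q, Polynomial.aeval f P (u q) = P.eval q • u q := by
    intro P q
    by_cases h : u q = 0
    · simp [h]
    · exact Module.End.aeval_apply_of_hasEigenvector
        ⟨Module.End.mem_eigenspace_iff.2 (hu q), h⟩
  have hK : kry f j = Submodule.span ℝ (Set.range fun q : S => u q) := by
    apply le_antisymm
    · apply sInf_le
      constructor
      · rw [hsum]
        refine Submodule.sum_mem _ fun q hq => ?_
        exact Submodule.subset_span ⟨⟨q, hfin.mem_toFinset.1 hq⟩, rfl⟩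
      · intro x hx
        induction hx using Submodule.span_induction with
        | mem x h =>
          obtain ⟨q, rfl⟩ := h
          simp only [hu]
          exact Submodule.smul_mem _ _ (Submodule.subset_span ⟨q, rfl⟩)
        | zero => simp
        | add x y _ _ hx hy => rw [map_add]; exact Submodule.add_mem _ hx hy
        | smul a x _ hx => rw [map_smul]; exact Submodule.smul_mem _ _ hx
    · refine le_sInf ?_
      rintro p ⟨hj, hp⟩
      rw [Submodule.span_le]
      rintro _ ⟨q, rfl⟩
      have h := invt_aeval f p hp (Lagrange.basis hfin.toFinset id (q : ℝ)) j hj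
      rw [hsum, map_sum, Finset.sum_eq_single (q : ℝ), haev] at h
      · have e := Lagrange.eval_basis_self (s := hfin.toFinset) (v := (id : ℝ → ℝ))
          (i := (q : ℝ)) (Set.injOn_id _) (hfin.mem_toFinset.2 q.2)
        simp only [id] at e
        rw [e, one_smul] at h
        exact h
      · intro r hr hne
        have e := Lagrange.eval_basis_of_ne (s := hfin.toFinset) (v := (id : ℝ → ℝ))
          hne.symm hr
        simp only [id] at e
        rw [haev, e, zero_smul]
      · intro h; exact absurd (hfin.mem_toFinset.2 q.2) h
  have : Fintype S := hfin.fintype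
  rw [hK, finrank_span_eq_card, ← Nat.card_coe_set_eq, Nat.card_eq_fintype_card]
  exact Module.End.eigenvectors_linearIndependent f S _ fun q =>
    ⟨Module.End.mem_eigenspace_iff.2 (hu q), hu0 q q.2⟩

theorem kry_le {E : Type*} [NormedAddCommGroup E] [InnerProductSpace ℝ E]
    (f g : Module.End ℝ E) (j : E) (a : ℝ)
    (h : ∀ x, f x + g x = a • x + inner ℝ j x • j) : kry f j ≤ kry g j := by
  refine le_sInf ?_
  rintro p ⟨hj, hp⟩
  refine sInf_le ⟨hj, fun x hx => ?_⟩
  rw [eq_sub_of_add_eq (h x)]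
  exact p.sub_mem (p.add_mem (p.smul_mem _ hx) (p.smul_mem _ hj)) (hp x hx)

theorem main_ncard_compl {E : Type*} [NormedAddCommGroup E] [InnerProductSpace ℝ E]
    [FiniteDimensional ℝ E] (f g : Module.End ℝ E) (hf : LinearMap.IsSymmetric f)
    (hg : LinearMap.IsSymmetric g) (j : E) (a : ℝ)
    (h : ∀ x, f x + g x = a • x + inner ℝ j x • j) :
    {q : ℝ | ∃ x, f x = q • x ∧ inner ℝ j x ≠ 0}.ncard =
    {q : ℝ | ∃ x, g x = q • x ∧ inner ℝ j x ≠ 0}.ncard := by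
  rw [(main_ncard_eq_finrank f hf j).1, (main_ncard_eq_finrank g hg j).1,
    le_antisymm (kry_le f g j a h) (kry_le g f j a fun x => by rw [add_comm, h])]

open Classical in
theorem sl_mulVec {V : Type*} [Fintype V] (G : SimpleGraph V) (x : V → ℝ) (v : V) :
    (signlessLaplacian G).mulVec x v = ∑ w, if G.Adj v w then x v + x w else 0 := by
  unfold signlessLaplacian
  rw [Matrix.add_mulVec, Pi.add_apply, Matrix.mulVec_diagonal, SimpleGraph.adjMatrix_mulVec_apply,
    ← Finset.sum_filter, Finset.sum_add_distrib, Finset.sum_const, nsmul_eq_mul]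
  have : G.neighborFinset v = Finset.univ.filter (fun w => G.Adj v w) := by
    ext w; simp
  rw [← SimpleGraph.card_neighborFinset_eq_degree, this]

theorem sl_herm {V : Type*} [Fintype V] (G : SimpleGraph V) :
    (signlessLaplacian G).IsHermitian := by
  unfold signlessLaplacian
  apply Matrix.IsHermitian.add
  · letI := Classical.decEq V
    apply Matrix.isHermitian_diagonal
  · rw [Matrix.IsHermitian, Matrix.conjTranspose_eq_transpose_of_trivial]
    letI := Classical.decRel G.Adj
    exact SimpleGraph.transpose_adjMatrix _

open Classical in
theorem main_set_eq {V : Type*} [Fintype V] (G : SimpleGraph V) :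
    {q : ℝ | IsMainQEigenvalue G q} = {q : ℝ | ∃ x : EuclideanSpace ℝ V,
      (signlessLaplacian G).toEuclideanLin x = q • x ∧
        inner ℝ (WithLp.toLp 2 (fun _ => (1 : ℝ)) : EuclideanSpace ℝ V) x ≠ 0} := by
  ext q
  constructor
  · rintro ⟨x, hx, hs⟩
    refine ⟨WithLp.toLp 2 x, ?_, ?_⟩
    · rw [Matrix.toLpLin_toLp, Matrix.toLin'_apply, hx]; rfl
    · simpa [PiLp.inner_apply] using hs
  · rintro ⟨x, hx, hs⟩
    refine ⟨x.ofLp, ?_, ?_⟩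
    · have := congrArg WithLp.ofLp hx
      simpa using this
    · simpa [PiLp.inner_apply] using hs

theorem main_finite {V : Type*} [Fintype V] (G : SimpleGraph V) :
    {q : ℝ | IsMainQEigenvalue G q}.Finite := by
  classical
  rw [main_set_eq]
  exact (main_ncard_eq_finrank _ (Matrix.isSymmetric_toEuclideanLin_iff.2 (sl_herm G)) _).2

theorem mainQCount_compl {V : Type*} [Fintype V] (G : SimpleGraph V) :
    mainQCount G = mainQCount Gᶜ := by
  classical
  unfold mainQCount
  rw [main_set_eq, main_set_eq]
  refine main_ncard_compl _ _ (Matrix.isSymmetric_toEuclideanLin_iff.2 (sl_herm G))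
    (Matrix.isSymmetric_toEuclideanLin_iff.2 (sl_herm Gᶜ)) _ ((Fintype.card V : ℝ) - 2) ?_
  intro x
  ext v
  simp only [PiLp.add_apply, Matrix.toLpLin_apply, PiLp.smul_apply, sl_mulVec, smul_eq_mul,
    PiLp.inner_apply, ← Finset.sum_add_distrib]
  trans ∑ w, ((x v + x w) - if w = v then 2 * x v else 0)
  · refine Finset.sum_congr rfl fun w _ => ?_
    by_cases hw : w = v
    · subst hw; simp; ring
    · by_cases ha : G.Adj v w <;> simp [SimpleGraph.compl_adj, hw, ha, Ne.symm hw]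
  rw [Finset.sum_sub_distrib, Finset.sum_add_distrib]
  simp
  ring

theorem join_compl_main {W : Type*} [Fintype W] (c : ℕ) (hc : 1 ≤ c) (H : SimpleGraph W) :
    {q : ℝ | IsMainQEigenvalue (graphJoin (⊤ : SimpleGraph (Fin c)) H)ᶜ q} =
      insert 0 {q : ℝ | IsMainQEigenvalue Hᶜ q} := by
  classical
  set G := (graphJoin (⊤ : SimpleGraph (Fin c)) H)ᶜ with hG
  have hll : ∀ a b, ¬ G.Adj (Sum.inl a) (Sum.inl b) := by
    intro a b h
    rw [hG, SimpleGraph.compl_adj] at h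
    exact h.2 (show (⊤ : SimpleGraph (Fin c)).Adj a b from fun e => h.1 (by rw [e]))
  have hlr : ∀ a b, ¬ G.Adj (Sum.inl a) (Sum.inr b) := by
    intro a b h
    rw [hG, SimpleGraph.compl_adj] at h
    exact h.2 trivial
  have hrl : ∀ a b, ¬ G.Adj (Sum.inr a) (Sum.inl b) := fun a b h => hlr b a h.symm
  have hrr : ∀ a b, G.Adj (Sum.inr a) (Sum.inr b) ↔ Hᶜ.Adj a b := by
    intro a b
    rw [hG, SimpleGraph.compl_adj, SimpleGraph.compl_adj]
    exact and_congr (by simp) Iff.rfl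
  have hQl : ∀ x a, (signlessLaplacian G).mulVec x (Sum.inl a) = 0 := by
    intro x a
    rw [sl_mulVec]
    simp [hll, hlr]
  have hQr : ∀ x a, (signlessLaplacian G).mulVec x (Sum.inr a) =
      (signlessLaplacian Hᶜ).mulVec (fun b => x (Sum.inr b)) a := by
    intro x a
    rw [sl_mulVec, sl_mulVec, Fintype.sum_sum_type]
    simp only [hrl, hrr, if_false, Finset.sum_const_zero, zero_add]
    refine Finset.sum_congr rfl fun w _ => ?_
    by_cases h : Hᶜ.Adj a w <;> simp only [h, if_true, if_false]
  ext q
  constructor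
  · rintro ⟨x, hx, hs⟩
    by_cases hq : q = 0
    · exact Or.inl hq
    · right
      refine ⟨fun b => x (Sum.inr b), ?_, ?_⟩
      · funext a
        rw [← hQr, hx]; rfl
      · have hl : ∀ a, x (Sum.inl a) = 0 := by
          intro a
          have := congrFun hx (Sum.inl a)
          rw [hQl, Pi.smul_apply, smul_eq_mul] at this
          exact (mul_eq_zero.1 this.symm).resolve_left hq
        rw [Fintype.sum_sum_type] at hs
        simpa [hl] using hs
  · rintro (rfl | ⟨x, hx, hs⟩)
    · refine ⟨Sum.elim (fun _ => 1) (fun _ => 0), ?_, ?_⟩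
      · funext v
        rcases v with a | a
        · simp [hQl]
        · rw [hQr]
          simp only [Sum.elim_inr, sl_mulVec]
          simp
      · rw [Fintype.sum_sum_type]
        simp
        omega
    · refine ⟨Sum.elim (fun _ => 0) x, ?_, ?_⟩
      · funext v
        rcases v with a | a
        · simp [hQl]
        · rw [hQr]
          simpa using congrFun hx a
      · rw [Fintype.sum_sum_type]
        simpa using hs

theorem nonbip {W : Type*} [Fintype W] (G : SimpleGraph W) (hG : G.Preconnected)
    (hm : IsMainQEigenvalue G 0) : G.Colorable 2 := by
  classical
  obtain ⟨x, hx, hs⟩ := hm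
  have h0 : ∑ v, ∑ w, (if G.Adj v w then x v * (x v + x w) else 0) = 0 := by
    have : ∀ v, ∑ w, (if G.Adj v w then x v * (x v + x w) else 0) = 0 := by
      intro v
      have := congrFun hx v
      rw [sl_mulVec] at this
      calc _ = x v * ∑ w, (if G.Adj v w then x v + x w else 0) := by
            rw [Finset.mul_sum]; exact Finset.sum_congr rfl fun w _ => by split_ifs <;> simp
        _ = 0 := by rw [this]; simp
    simp [this]
  have h1 := h0
  rw [Finset.sum_comm] at h1
  have h2 : ∑ v, ∑ w, (if G.Adj v w then (x v + x w) ^ 2 else 0) = 0 := by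
    have h01 := congrArg₂ (· + ·) h0 h1
    simp only [← Finset.sum_add_distrib, add_zero] at h01
    refine Eq.trans ?_ h01
    refine Finset.sum_congr rfl fun v _ => Finset.sum_congr rfl fun w _ => ?_
    rw [G.adj_comm w v]
    split_ifs
    · ring
    · simp
  have hadj : ∀ v w, G.Adj v w → x v + x w = 0 := by
    intro v w h
    have hn : ∀ v w, 0 ≤ (if G.Adj v w then (x v + x w) ^ 2 else 0) := by
      intro v w; split_ifs <;> positivity
    have h3 := (Finset.sum_eq_zero_iff_of_nonneg
      (fun v _ => Finset.sum_nonneg fun w _ => hn v w)).1 h2 v (Finset.mem_univ _)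
    have h4 := (Finset.sum_eq_zero_iff_of_nonneg (fun w _ => hn v w)).1 h3 w (Finset.mem_univ _)
    rw [if_pos h] at h4
    exact pow_eq_zero_iff (two_ne_zero) |>.1 h4
  have habs : ∀ v w, |x v| = |x w| := by
    intro v w
    obtain ⟨p⟩ := hG v w
    induction p with
    | nil => rfl
    | cons h p ih => rw [← ih, eq_neg_of_add_eq_zero_left (hadj _ _ h), abs_neg]
  have hne : ∀ v, x v ≠ 0 := by
    intro v hv
    apply hs
    refine Finset.sum_eq_zero fun w _ => ?_
    rw [← abs_eq_zero, habs w v, hv, abs_zero]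
  have col : G.Coloring Bool := SimpleGraph.Coloring.mk (fun v => decide (0 < x v)) ?_
  · simpa using col.colorable
  · intro v w h e
    have := hadj v w h
    have := hne v
    rw [decide_eq_decide] at e
    rcases lt_or_gt_of_ne (hne v) with hv | hv
    · have := e.2 (by linarith); linarith
    · have := e.1 hv; linarith

theorem bip {W : Type*} [Fintype W] (H : SimpleGraph W) (hH : ¬ H.Preconnected)
    (hcol : Hᶜ.Colorable 2) (q : ℝ) (hm : IsMainQEigenvalue Hᶜ q) :
    q = 0 ∨ q = Fintype.card W := by
  classical
  obtain ⟨C⟩ := hcol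
  obtain ⟨x, hx, hs⟩ := hm
  have hd : ∀ u v, ¬ H.Reachable u v → C u ≠ C v := fun u v h =>
    C.valid ((H.reachable_or_compl_adj u v).resolve_left h)
  have hr : ∀ u v, H.Reachable u v → C u = C v := by
    intro u v h
    have : ∃ w, ¬ H.Reachable u w := by
      by_contra hc
      push Not at hc
      exact hH fun a b => (hc a).symm.trans (hc b)
    obtain ⟨w, hw⟩ := this
    have h1 := hd u w hw
    have h2 := hd v w (fun h' => hw (h.trans h'))
    omega
  have hadj : ∀ u v, Hᶜ.Adj u v ↔ C u ≠ C v := by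
    intro u v
    constructor
    · exact fun h => C.valid h
    · intro h
      exact (H.reachable_or_compl_adj u v).resolve_left fun h' => h (hr u v h')
  let S : Fin 2 → ℝ := fun i => ∑ w, if C w = i then x w else 0
  let N : Fin 2 → ℝ := fun i => ∑ w, if C w = i then 1 else 0
  have hv : ∀ v, N (1 - C v) * x v + S (1 - C v) = q * x v := by
    intro v
    have := congrFun hx v
    rw [sl_mulVec] at this
    rw [← smul_eq_mul q, ← Pi.smul_apply, ← this]
    simp only [N, S, Finset.sum_mul, ← Finset.sum_add_distrib]
    refine Finset.sum_congr rfl fun w _ => ?_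
    rw [hadj]
    have : C w = 1 - C v ↔ C v ≠ C w := by
      generalize C w = a
      generalize C v = b
      revert a b; decide
    simp only [this]
    split_ifs <;> simp
  have hS : ∀ i, N (1 - i) * S i + S (1 - i) * N i = q * S i := by
    intro i
    simp only [show S i = ∑ w, if C w = i then x w else 0 from rfl,
      show N i = ∑ w, if C w = i then 1 else 0 from rfl, Finset.mul_sum,
      ← Finset.sum_add_distrib]
    refine Finset.sum_congr rfl fun w _ => ?_
    split_ifs with h
    · rw [← hv w, h]; ring
    · simp
  have e0 := hS 0
  have e1 := hS 1
  have hsum : S 0 + S 1 = ∑ v, x v := by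
    simp only [S, ← Finset.sum_add_distrib]
    refine Finset.sum_congr rfl fun w _ => ?_
    generalize C w = a
    fin_cases a <;> simp
  have hN : N 0 + N 1 = Fintype.card W := by
    simp only [N, ← Finset.sum_add_distrib]
    rw [← Finset.card_univ, Finset.card_eq_sum_ones, Nat.cast_sum]
    refine Finset.sum_congr rfl fun w _ => ?_
    generalize C w = a
    fin_cases a <;> simp
  simp only [sub_zero, sub_self] at e0 e1
  by_cases hq : q = 0
  · exact Or.inl hq
  · right
    have h1 : q * (S 0 - S 1) = 0 := by linarith
    have h2 : S 0 = S 1 := by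
      have := (mul_eq_zero.1 h1).resolve_left hq; linarith
    have h3 : S 0 ≠ 0 := by
      intro h; apply hs; rw [← hsum, ← h2, h]; simp
    rw [← hN]
    apply mul_right_cancel₀ h3
    rw [← h2] at e0
    linarith

theorem quasiThreshold_join_main_count_dichotomy
    {W : Type*} [Fintype W] (c : ℕ) (hc : 1 ≤ c) (H : SimpleGraph W)
    (hHqt : IsQuasiThreshold H) (hHdisc : ¬ H.Connected)
    (hGqt : IsQuasiThreshold (graphJoin (⊤ : SimpleGraph (Fin c)) H))
    (hGconn : (graphJoin (⊤ : SimpleGraph (Fin c)) H).Connected)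
    (k : ℕ) (hk : 2 ≤ k)
    (hmain : mainQCount (graphJoin (⊤ : SimpleGraph (Fin c)) H) = k) :
    Xor'
      (¬ (Hᶜ).Colorable 2 ∧ mainQCount Hᶜ = k - 1 ∧
        ∀ q : ℝ, IsMainQEigenvalue Hᶜ q → q ≠ 0)
      ((Hᶜ).Colorable 2 ∧ k = 2) := by
  rw [mainQCount_compl, mainQCount, join_compl_main c hc H] at hmain
  have hne : Nonempty W := by
    by_contra h
    rw [not_nonempty_iff] at h
    have : {q : ℝ | IsMainQEigenvalue Hᶜ q} = ∅ := by
      ext q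
      simp [IsMainQEigenvalue]
    rw [this] at hmain
    simp at hmain
    omega
  have hpre : ¬ H.Preconnected := fun h => hHdisc ⟨h⟩
  by_cases hcol : Hᶜ.Colorable 2
  · refine Or.inr ⟨⟨hcol, ?_⟩, fun h => h.1 hcol⟩
    have hsub : insert 0 {q : ℝ | IsMainQEigenvalue Hᶜ q} ⊆ {0, (Fintype.card W : ℝ)} := by
      rintro q (rfl | hq)
      · simp
      · exact bip H hpre hcol q hq
    have h1 := Set.ncard_le_ncard hsub (by simp)
    have h2 := Set.ncard_insert_le (0 : ℝ) {(Fintype.card W : ℝ)}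
    rw [Set.ncard_singleton] at h2
    omega
  · have h0 : ¬ IsMainQEigenvalue Hᶜ 0 := fun h =>
      hcol (nonbip Hᶜ (H.connected_or_preconnected_compl.resolve_left hHdisc) h)
    refine Or.inl ⟨⟨hcol, ?_, ?_⟩, fun h => hcol h.1⟩
    · rw [Set.ncard_insert_of_notMem (s := {q : ℝ | IsMainQEigenvalue Hᶜ q}) h0 (main_finite _)] at hmain
      unfold mainQCount
      omega
    · rintro q hq rfl
      exact h0 hq
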